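/- arXiv:1811.02747 — 14 statements merged into one kernel-verified Lean document; each statement's English description precedes it below -/
import Mathlib

section
/- Let G be a finite simple graph with no isolated vertices. Then ∑_{i∈V(G)} m_i² ≥ ∑_{i∈V(G)} d_i² (as rational numbers), with equality if and only if m_i = d_i for every vertex i. -/
open Finset

/-- The average 2-degree `m_i` of a vertex `i`, as a rational number. -/
noncomputable def SimpleGraph.avgTwoDeg {V : Type*} [Fintype V]
    (G : SimpleGraph V) [DecidableRel G.Adj] (i : V) : ℚ :=
  (∑ j ∈ G.neighborFinset i, (G.degree j : ℚ)) / (G.degree i : ℚ)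

theorem SimpleGraph.degree_mul_avgTwoDeg {V : Type*} [Fintype V]
    (G : SimpleGraph V) [DecidableRel G.Adj] {i : V} (hi : 0 < G.degree i) :
    (G.degree i : ℚ) * G.avgTwoDeg i = ∑ j ∈ G.neighborFinset i, (G.degree j : ℚ) :=
  mul_div_cancel₀ _ (Nat.cast_ne_zero.mpr hi.ne')

theorem SimpleGraph.sum_sum_neighborFinset {V R : Type*} [Fintype V] [Semiring R]
    (G : SimpleGraph V) [DecidableRel G.Adj] (f : V → R) :
    ∑ i, ∑ j ∈ G.neighborFinset i, f j = ∑ i, (G.degree i : R) * f i := by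
  rw [Finset.sum_comm' (t' := Finset.univ) (s' := fun j => G.neighborFinset j)
    (fun i j => by simp [G.adj_comm])]
  simp

theorem SimpleGraph.sum_avgTwoDeg_sub_degree_sq {V : Type*} [Fintype V]
    (G : SimpleGraph V) [DecidableRel G.Adj] (hiso : ∀ i : V, 0 < G.degree i) :
    ∑ i, (G.avgTwoDeg i - G.degree i) ^ 2 =
      ∑ i, G.avgTwoDeg i ^ 2 - ∑ i, (G.degree i : ℚ) ^ 2 := by
  have h : ∑ i, (G.degree i : ℚ) * G.avgTwoDeg i = ∑ i, (G.degree i : ℚ) ^ 2 := by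
    simp_rw [G.degree_mul_avgTwoDeg (hiso _), G.sum_sum_neighborFinset, sq]
  calc ∑ i, (G.avgTwoDeg i - G.degree i) ^ 2
      = ∑ i, (G.avgTwoDeg i ^ 2 - 2 * (G.degree i * G.avgTwoDeg i) + (G.degree i : ℚ) ^ 2) :=
        Finset.sum_congr rfl fun i _ => by ring
    _ = _ := by
        rw [Finset.sum_add_distrib, Finset.sum_sub_distrib, ← Finset.mul_sum, h]
        ring

/-- For a finite simple graph with no isolated vertices,
`∑ m_i² ≥ ∑ d_i²` (over `ℚ`), with equality iff `m_i = d_i` for every vertex `i`. -/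
theorem sum_avgTwoDeg_sq_ge_sum_deg_sq {V : Type*} [Fintype V]
    (G : SimpleGraph V) [DecidableRel G.Adj]
    (hiso : ∀ i : V, 0 < G.degree i) :
    (∑ i : V, (G.degree i : ℚ) ^ 2 ≤ ∑ i : V, (G.avgTwoDeg i) ^ 2) ∧
    (∑ i : V, (G.avgTwoDeg i) ^ 2 = ∑ i : V, (G.degree i : ℚ) ^ 2 ↔
      ∀ i : V, G.avgTwoDeg i = (G.degree i : ℚ)) := by
  have h := G.sum_avgTwoDeg_sub_degree_sq hiso
  constructor
  · rw [← sub_nonneg, ← h]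
    positivity
  · rw [← sub_eq_zero, ← h, Finset.sum_eq_zero_iff_of_nonneg fun i _ => sq_nonneg _]
    simp [sub_eq_zero]
end

section
/- Let G be a finite simple graph on n vertices with no isolated vertices. If there exists a vertex i with d_i·m_i ≥ n (i.e., ∑_{j adjacent to i} d_j ≥ n), then the girth of G is at most 4; that is, G contains a cycle of length 3 or a cycle of length 4. -/
open Finset

/-- Three pairwise adjacent vertices span a cycle of length `3`. -/
theorem SimpleGraph.exists_isCycle_length_three {V : Type*} {G : SimpleGraph V} {a b c : V}
    (hab : G.Adj a b) (hbc : G.Adj b c) (hca : G.Adj c a) :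
    ∃ w : G.Walk a a, w.IsCycle ∧ w.length = 3 := by
  refine ⟨.cons hab (.cons hbc (.cons hca .nil)), ?_, rfl⟩
  have := hab.ne
  have := hbc.ne
  have := hca.ne
  rw [SimpleGraph.Walk.cons_isCycle_iff]
  simp
  grind

/-- A closed walk `a, b, c, d, a` with `a ≠ c` and `b ≠ d` is a cycle of length `4`. -/
theorem SimpleGraph.exists_isCycle_length_four {V : Type*} {G : SimpleGraph V} {a b c d : V}
    (hab : G.Adj a b) (hbc : G.Adj b c) (hcd : G.Adj c d) (hda : G.Adj d a)
    (hac : a ≠ c) (hbd : b ≠ d) :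
    ∃ w : G.Walk a a, w.IsCycle ∧ w.length = 4 := by
  refine ⟨.cons hab (.cons hbc (.cons hcd (.cons hda .nil))), ?_, rfl⟩
  have := hab.ne
  have := hbc.ne
  have := hcd.ne
  have := hda.ne
  rw [SimpleGraph.Walk.cons_isCycle_iff]
  simp
  grind

/-- If a finite simple graph `G` on `n` vertices with no isolated
vertices has a vertex `i` with `d_i·m_i = ∑_{j ~ i} d_j ≥ n`, then `G` contains a
cycle of length `3` or a cycle of length `4` (so its girth is at most `4`). -/
theorem girth_le_four_of_exists_large_deg_mul_avgTwoDeg {V : Type*} [Fintype V]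
    (G : SimpleGraph V) [DecidableRel G.Adj]
    (hiso : ∀ i : V, 0 < G.degree i)
    (h : ∃ i : V, Fintype.card V ≤ ∑ j ∈ G.neighborFinset i, G.degree j) :
    ∃ (v : V) (c : G.Walk v v), c.IsCycle ∧ (c.length = 3 ∨ c.length = 4) := by
  classical
  obtain ⟨i, hi⟩ := h
  let s : Finset (Σ _ : V, V) := (G.neighborFinset i).sigma fun j => G.neighborFinset j
  -- Send a walk `i, j, k` to `k`, except that `i, j, i` is sent to `j`; this never hits `i`.
  let f : (Σ _ : V, V) → V := fun p => if p.2 = i then p.1 else p.2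
  have hcard : (univ.erase i).card < s.card := by
    have hs : s.card = ∑ j ∈ G.neighborFinset i, G.degree j := by simp [s, card_sigma]
    rw [hs]
    exact (card_erase_lt_of_mem (mem_univ i)).trans_le hi
  have hmaps : ∀ p ∈ s, f p ∈ univ.erase i := by
    rintro ⟨j, k⟩ hp
    simp only [s, mem_sigma, SimpleGraph.mem_neighborFinset] at hp
    have := hp.1.ne
    simp only [f, mem_erase, mem_univ, and_true]
    grind
  obtain ⟨⟨j, k⟩, hp, ⟨j', k'⟩, hp', hne, heq⟩ :=
    exists_ne_map_eq_of_card_lt_of_maps_to hcard hmaps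
  simp only [s, mem_sigma, SimpleGraph.mem_neighborFinset] at hp hp'
  obtain ⟨hij, hjk⟩ := hp
  obtain ⟨hij', hjk'⟩ := hp'
  simp only [f] at heq
  split_ifs at heq with hk hk' hk'
  · subst hk hk' heq
    exact absurd rfl hne
  · subst heq
    obtain ⟨w, hw, hl⟩ := SimpleGraph.exists_isCycle_length_three hij hjk'.symm hij'.symm
    exact ⟨i, w, hw, .inl hl⟩
  · subst heq
    obtain ⟨w, hw, hl⟩ := SimpleGraph.exists_isCycle_length_three hij hjk hij'.symm
    exact ⟨i, w, hw, .inl hl⟩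
  · subst heq
    have hjj' : j ≠ j' := by
      rintro rfl
      exact hne rfl
    obtain ⟨w, hw, hl⟩ :=
      SimpleGraph.exists_isCycle_length_four hij hjk hjk'.symm hij'.symm (Ne.symm hk) hjj'
    exact ⟨i, w, hw, .inr hl⟩
end

section
/- Let G be a finite simple graph with no isolated vertices and let S be any set of k vertices of G. Then ∑_{i∈S} d_i·m_i ≤ ∑_{i∈S} d_i·min(d_i, k−1) + ∑_{i∉S} d_i·min(d_i, k), where d_i·m_i = ∑_{j adjacent to i} d_j. -/
open Finset

/-- For a finite simple graph `G` with no isolated vertices and any set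
`S` of `k` vertices,
`∑_{i∈S} d_i·m_i ≤ ∑_{i∈S} d_i·min(d_i, k−1) + ∑_{i∉S} d_i·min(d_i, k)`,
where `d_i·m_i = ∑_{j ~ i} d_j`. -/
theorem sum_deg_mul_avgTwoDeg_le {V : Type*} [Fintype V] [DecidableEq V]
    (G : SimpleGraph V) [DecidableRel G.Adj]
    (hiso : ∀ i : V, 0 < G.degree i)
    (S : Finset V) (k : ℕ) (hS : S.card = k) :
    ∑ i ∈ S, ∑ j ∈ G.neighborFinset i, G.degree j ≤
      ∑ i ∈ S, G.degree i * min (G.degree i) (k - 1) +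
      ∑ i ∈ Sᶜ, G.degree i * min (G.degree i) k := by
  have hswap : ∑ i ∈ S, ∑ j ∈ G.neighborFinset i, G.degree j =
      ∑ j, G.degree j * (G.neighborFinset j ∩ S).card := by
    rw [Finset.sum_comm' (t' := Finset.univ) (s' := fun j => G.neighborFinset j ∩ S)]
    · simp [mul_comm]
    · intro i j
      simp [G.adj_comm, and_comm]
  have hdeg (j : V) : (G.neighborFinset j ∩ S).card ≤ G.degree j :=
    card_le_card inter_subset_left
  rw [hswap, ← Finset.sum_add_sum_compl S]
  refine add_le_add (sum_le_sum fun j hj => ?_) (sum_le_sum fun j _ => ?_)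
  · refine Nat.mul_le_mul_left _ (le_min (hdeg j) ?_)
    rw [← hS, ← card_erase_of_mem hj]
    refine card_le_card fun i hi => ?_
    rw [mem_inter, SimpleGraph.mem_neighborFinset] at hi
    exact mem_erase.2 ⟨hi.1.ne', hi.2⟩
  · exact Nat.mul_le_mul_left _ (le_min (hdeg j) (hS ▸ card_le_card inter_subset_right))
end

section
/- Let G be a nonempty finite simple graph with no isolated vertices, and suppose k is a rational number such that m_i = k for every vertex i of G (i.e., ∑_{j adjacent to i} d_j = k·d_i for all i). Then k is a positive integer. -/
open Finset

/-- A rational number all of whose powers become integers after multiplication by a fixed positive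
integer has denominator one. -/
theorem Rat.den_eq_one_of_forall_pow_mul_eq_intCast {k : ℚ} {d : ℕ} (hd : 0 < d)
    (h : ∀ n : ℕ, ∃ z : ℤ, k ^ n * d = z) : k.den = 1 := by
  by_contra hk
  have hden : 1 < k.den := by have := k.den_pos; omega
  obtain ⟨z, hz⟩ := h d
  have hq : (k.den : ℚ) ≠ 0 := by exact_mod_cast k.den_nz
  have hcast : (k.num ^ d * d : ℚ) = k.den ^ d * z := by
    rw [← hz, ← mul_assoc, ← mul_pow, mul_comm (k.den : ℚ) k, Rat.mul_den_eq_num]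
  have hint : k.num ^ d * (d : ℤ) = (k.den : ℤ) ^ d * z := by exact_mod_cast hcast
  have hcop : IsCoprime ((k.den : ℤ) ^ d) (k.num ^ d) :=
    (Int.isCoprime_iff_gcd_eq_one.2 (by simpa [Int.gcd] using k.reduced)).symm.pow
  have hdvd : k.den ^ d ∣ d := by
    exact_mod_cast hcop.dvd_of_dvd_mul_left (Dvd.intro z hint.symm)
  exact absurd (Nat.le_of_dvd hd hdvd) (Nat.lt_pow_self hden).not_ge

/-- In a graph with constant average 2-degree `k`, the numbers `k ^ n * d_i` count walks, so they
are integers. -/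
theorem SimpleGraph.exists_intCast_eq_pow_mul_degree {V : Type*} [Fintype V]
    (G : SimpleGraph V) [DecidableRel G.Adj] {k : ℚ}
    (hharm : ∀ i : V, (∑ j ∈ G.neighborFinset i, (G.degree j : ℚ)) = k * G.degree i)
    (n : ℕ) (i : V) : ∃ z : ℤ, k ^ n * G.degree i = z := by
  induction n generalizing i with
  | zero => exact ⟨G.degree i, by simp⟩
  | succ n ih =>
    choose z hz using ih
    refine ⟨∑ j ∈ G.neighborFinset i, z j, ?_⟩
    rw [pow_succ, mul_assoc, ← hharm, Finset.mul_sum, Int.cast_sum]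
    exact Finset.sum_congr rfl fun j _ => hz j

/-- If `G` is a nonempty finite simple graph with no isolated vertices
and `k : ℚ` satisfies `m_i = k` for every vertex `i` (i.e. `∑_{j ~ i} d_j = k·d_i`),
then `k` is a positive integer. -/
theorem harmonic_const_is_pos_int {V : Type*} [Fintype V] [Nonempty V]
    (G : SimpleGraph V) [DecidableRel G.Adj]
    (hiso : ∀ i : V, 0 < G.degree i) (k : ℚ)
    (hharm : ∀ i : V, (∑ j ∈ G.neighborFinset i, (G.degree j : ℚ)) = k * G.degree i) :
    ∃ m : ℕ, 0 < m ∧ k = m := by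
  obtain ⟨i⟩ := ‹Nonempty V›
  have hden : k.den = 1 := Rat.den_eq_one_of_forall_pow_mul_eq_intCast (hiso i)
    fun n => G.exists_intCast_eq_pow_mul_degree hharm n i
  have hsum : 0 < ∑ j ∈ G.neighborFinset i, (G.degree j : ℚ) :=
    Finset.sum_pos (fun j _ => by exact_mod_cast hiso j)
      (Finset.card_pos.1 (by simpa using hiso i))
  have hpos : 0 < k := by
    rw [hharm] at hsum
    exact pos_of_mul_pos_left hsum (Nat.cast_nonneg _)
  have hnum : 0 < k.num := Rat.num_pos.2 hpos
  refine ⟨k.num.toNat, by omega, ?_⟩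
  have hk : (k.num : ℚ) = k := Rat.coe_int_num_of_den_eq_one hden
  rw [← Int.cast_natCast, Int.toNat_of_nonneg hnum.le, hk]
end

section
/- Let G be a k-harmonic finite simple graph on n vertices with no isolated vertices, where k is a positive integer. Then the number of edges of G satisfies |E(G)| ≤ n·k/2, with equality if and only if G is regular (all vertices have the same degree). -/
open Finset

/-- The sum of the degrees of all neighbours of all vertices is the sum of the squared degrees. -/
theorem SimpleGraph.sum_sum_degree_neighborFinset {V : Type*} [Fintype V]
    (G : SimpleGraph V) [DecidableRel G.Adj] :
    ∑ i, ∑ j ∈ G.neighborFinset i, G.degree j = ∑ i, G.degree i ^ 2 := by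
  rw [Finset.sum_comm' (t' := univ) (s' := fun j => G.neighborFinset j)
    (by simp [G.adj_comm])]
  simp [sq]

/-- In a `k`-harmonic graph, the squared deviation of the degrees from `k` equals `k (n k - 2 m)`. -/
theorem SimpleGraph.sum_sq_degree_sub_of_harmonic {V : Type*} [Fintype V]
    (G : SimpleGraph V) [DecidableRel G.Adj] (k : ℕ)
    (hharm : ∀ i : V, ∑ j ∈ G.neighborFinset i, G.degree j = k * G.degree i) :
    ∑ i, ((G.degree i : ℤ) - k) ^ 2 =
      k * ((Fintype.card V : ℤ) * k - 2 * G.edgeFinset.card) := by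
  have hsum : (∑ i, (G.degree i : ℤ)) = 2 * G.edgeFinset.card := by
    exact_mod_cast G.sum_degrees_eq_twice_card_edges
  have hsq : (∑ i, (G.degree i : ℤ) ^ 2) = k * ∑ i, (G.degree i : ℤ) := by
    have h := G.sum_sum_degree_neighborFinset
    simp only [hharm, ← mul_sum] at h
    exact_mod_cast h.symm
  simp only [sub_sq, sum_add_distrib, sum_sub_distrib, ← sum_mul, ← mul_sum, hsq, hsum,
    sum_const, card_univ, nsmul_eq_mul]
  ring

/-- A `k`-harmonic graph on `n` vertices (`k` a positive integer)
has at most `n·k/2` edges, with equality iff the graph is regular. -/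
theorem harmonic_card_edge_le {V : Type*} [Fintype V]
    (G : SimpleGraph V) [DecidableRel G.Adj] (k : ℕ) (hk : 0 < k)
    (hiso : ∀ i : V, 0 < G.degree i)
    (hharm : ∀ i : V, ∑ j ∈ G.neighborFinset i, G.degree j = k * G.degree i) :
    2 * G.edgeFinset.card ≤ Fintype.card V * k ∧
    (2 * G.edgeFinset.card = Fintype.card V * k ↔ ∃ d : ℕ, ∀ i : V, G.degree i = d) := by
  have key := G.sum_sq_degree_sub_of_harmonic k hharm
  have hk' : (0 : ℤ) < k := by exact_mod_cast hk
  have hnonneg : (0 : ℤ) ≤ Fintype.card V * k - 2 * G.edgeFinset.card :=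
    nonneg_of_mul_nonneg_right (key ▸ sum_nonneg fun i _ => sq_nonneg _) hk'
  refine ⟨by exact_mod_cast sub_nonneg.mp hnonneg, fun h => ⟨k, fun i => ?_⟩, ?_⟩
  · have hzero : (Fintype.card V * k - 2 * G.edgeFinset.card : ℤ) = 0 :=
      sub_eq_zero.mpr (by exact_mod_cast h.symm)
    rw [hzero, mul_zero, sum_eq_zero_iff_of_nonneg fun i _ => sq_nonneg _] at key
    exact_mod_cast sub_eq_zero.mp (pow_eq_zero_iff two_ne_zero |>.mp (key i (mem_univ i)))
  · rintro ⟨d, hd⟩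
    have hdeg (i : V) : G.degree i = k := by
      have h := hharm i
      simp only [hd, sum_const, G.card_neighborFinset_eq_degree, smul_eq_mul] at h
      rw [hd, Nat.eq_of_mul_eq_mul_right (hd i ▸ hiso i) h]
    rw [← G.sum_degrees_eq_twice_card_edges]
    simp [hdeg]
end

section
/- Let G be a connected finite simple graph with no isolated vertices that is pseudo 2-regular, i.e., ∑_{j adjacent to i} d_j = 2·d_i for every vertex i, but the degree function is not constant. Then G is isomorphic to the tree T_2 on 7 vertices {0,1,2,3,4,5,6} with edge set {01, 02, 03, 14, 25, 36} (a root of degree 3 whose three neighbors each have exactly one leaf child). -/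
open Finset

/-- The tree `T₂` on 7 vertices: a root `0` of degree `3` whose neighbors `1, 2, 3`
each have exactly one leaf child (`4, 5, 6` respectively). -/
def T2 : SimpleGraph (Fin 7) :=
  SimpleGraph.fromEdgeSet {s(0, 1), s(0, 2), s(0, 3), s(1, 4), s(2, 5), s(3, 6)}

namespace SimpleGraph

variable {V : Type*} [Fintype V] {G : SimpleGraph V} [DecidableRel G.Adj]

/-- In a pseudo `2`-regular graph, the neighbor of a leaf has degree `2`. -/
theorem degree_eq_two_of_adj_leaf
    (hharm : ∀ i : V, ∑ j ∈ G.neighborFinset i, G.degree j = 2 * G.degree i)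
    {u v : V} (hu : G.degree u = 1) (huv : G.Adj u v) : G.degree v = 2 := by
  obtain ⟨w, hw⟩ := Finset.card_eq_one.mp ((G.card_neighborFinset_eq_degree u).trans hu)
  have hvw : v = w := by simpa [hw] using (G.mem_neighborFinset u v).mpr huv
  simpa [hw, hu, ← hvw] using hharm u

/-- In a pseudo `2`-regular graph, a vertex of degree `2` with a neighbor `u` has exactly one
other neighbor, and the degrees of these two neighbors add up to `4`. -/
theorem exists_other_neighbor
    (hharm : ∀ i : V, ∑ j ∈ G.neighborFinset i, G.degree j = 2 * G.degree i)
    {u v : V} (hv : G.degree v = 2) (hvu : G.Adj v u) :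
    ∃ w, (∀ x, G.Adj v x ↔ x = u ∨ x = w) ∧ G.degree u + G.degree w = 4 := by
  classical
  obtain ⟨a, b, hab, hN⟩ :=
    Finset.card_eq_two.mp ((G.card_neighborFinset_eq_degree v).trans hv)
  have hadj : ∀ x, G.Adj v x ↔ x = a ∨ x = b := fun x => by
    rw [← mem_neighborFinset, hN]; simp
  have hsum := hharm v
  rw [hN, Finset.sum_pair hab, hv] at hsum
  rcases (hadj u).mp hvu with rfl | rfl
  · exact ⟨b, hadj, hsum⟩
  · exact ⟨a, fun x => (hadj x).trans or_comm, by omega⟩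

/-- In a pseudo `2`-regular graph, all neighbors of a vertex of degree at least `3` have
degree `2`. -/
theorem degree_eq_two_of_adj_of_three_le
    (hharm : ∀ i : V, ∑ j ∈ G.neighborFinset i, G.degree j = 2 * G.degree i)
    {r : V} (hr : 3 ≤ G.degree r) {v : V} (hrv : G.Adj r v) : G.degree v = 2 := by
  have hge : ∀ j ∈ G.neighborFinset r, 2 ≤ G.degree j := fun j hj => by
    have hj' : G.Adj r j := (G.mem_neighborFinset r j).mp hj
    have hpos : 0 < G.degree j := (G.degree_pos_iff_exists_adj j).mpr ⟨r, hj'.symm⟩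
    by_contra hlt
    have := degree_eq_two_of_adj_leaf hharm (show G.degree j = 1 by omega) hj'.symm
    omega
  have hsum : ∑ j ∈ G.neighborFinset r, 2 = ∑ j ∈ G.neighborFinset r, G.degree j := by
    rw [hharm r, Finset.sum_const, card_neighborFinset_eq_degree, smul_eq_mul, mul_comm]
  exact ((Finset.sum_eq_sum_iff_of_le hge).mp hsum v ((G.mem_neighborFinset r v).mpr hrv)).symm

/-- A pseudo `2`-regular graph has a vertex of degree at least `3`. -/
theorem exists_three_le_degree
    (hiso : ∀ i : V, 0 < G.degree i)
    (hharm : ∀ i : V, ∑ j ∈ G.neighborFinset i, G.degree j = 2 * G.degree i)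
    (hnreg : ¬ ∃ d : ℕ, ∀ i : V, G.degree i = d) : ∃ r, 3 ≤ G.degree r := by
  by_contra! hlt
  refine hnreg ⟨2, fun i => ?_⟩
  by_contra hi
  have hi1 : G.degree i = 1 := by have := hiso i; have := hlt i; omega
  obtain ⟨v, hv⟩ := (G.degree_pos_iff_exists_adj i).mp (hiso i)
  obtain ⟨w, -, hw⟩ :=
    exists_other_neighbor hharm (degree_eq_two_of_adj_leaf hharm hi1 hv) hv.symm
  have := hlt w
  omega

/-- In a pseudo `2`-regular graph, a neighbor `v` of a vertex `r` of degree at least `3` is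
adjacent only to `r` and to a leaf, and `r` has degree `3`. -/
theorem exists_leaf_of_adj_of_three_le
    (hharm : ∀ i : V, ∑ j ∈ G.neighborFinset i, G.degree j = 2 * G.degree i)
    {r : V} (hr : 3 ≤ G.degree r) {v : V} (hrv : G.Adj r v) :
    G.degree r = 3 ∧ ∃ w, G.degree w = 1 ∧ (∀ x, G.Adj v x ↔ x = r ∨ x = w) ∧
      ∀ x, G.Adj w x ↔ x = v := by
  obtain ⟨w, hadj, hdeg⟩ := exists_other_neighbor hharm
    (degree_eq_two_of_adj_of_three_le hharm hr hrv) hrv.symm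
  have hwv : G.Adj w v := ((hadj w).mpr (Or.inr rfl)).symm
  have hpos : 0 < G.degree w := (G.degree_pos_iff_exists_adj w).mpr ⟨v, hwv⟩
  have hw : G.degree w = 1 := by omega
  refine ⟨by omega, w, hw, hadj, fun x => ⟨fun hx => ?_, fun hx => hx ▸ hwv⟩⟩
  obtain ⟨y, -, hy⟩ := degree_eq_one_iff_existsUnique_adj.mp hw
  exact (hy x hx).trans (hy v hwv).symm

end SimpleGraph

/-- A connected pseudo `2`-regular graph (i.e. `∑_{j ~ i} d_j = 2·d_i`
for every vertex `i`, but the degree function is not constant) is isomorphic to `T₂`. -/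
theorem pseudo_two_regular_iso_T2 {V : Type*} [Fintype V]
    (G : SimpleGraph V) [DecidableRel G.Adj]
    (hconn : G.Connected)
    (hiso : ∀ i : V, 0 < G.degree i)
    (hharm : ∀ i : V, ∑ j ∈ G.neighborFinset i, G.degree j = 2 * G.degree i)
    (hnreg : ¬ ∃ d : ℕ, ∀ i : V, G.degree i = d) :
    Nonempty (G ≃g T2) := by
  classical
  obtain ⟨r, hr⟩ := SimpleGraph.exists_three_le_degree hiso hharm hnreg
  obtain ⟨v, hv⟩ := (G.degree_pos_iff_exists_adj r).mp (hiso r)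
  have hr3 := (SimpleGraph.exists_leaf_of_adj_of_three_le hharm hr hv).1
  obtain ⟨a₁, a₂, a₃, h12, h13, h23, hN⟩ :=
    Finset.card_eq_three.mp ((G.card_neighborFinset_eq_degree r).trans hr3)
  have hradj : ∀ x, G.Adj r x ↔ x = a₁ ∨ x = a₂ ∨ x = a₃ := fun x => by
    rw [← SimpleGraph.mem_neighborFinset, hN]; simp
  have ha₁ : G.Adj r a₁ := by simp [hradj]
  have ha₂ : G.Adj r a₂ := by simp [hradj]
  have ha₃ : G.Adj r a₃ := by simp [hradj]
  have hd₁ := SimpleGraph.degree_eq_two_of_adj_of_three_le hharm hr ha₁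
  have hd₂ := SimpleGraph.degree_eq_two_of_adj_of_three_le hharm hr ha₂
  have hd₃ := SimpleGraph.degree_eq_two_of_adj_of_three_le hharm hr ha₃
  obtain ⟨-, b₁, hb₁, hadj₁, hleaf₁⟩ := SimpleGraph.exists_leaf_of_adj_of_three_le hharm hr ha₁
  obtain ⟨-, b₂, hb₂, hadj₂, hleaf₂⟩ := SimpleGraph.exists_leaf_of_adj_of_three_le hharm hr ha₂
  obtain ⟨-, b₃, hb₃, hadj₃, hleaf₃⟩ := SimpleGraph.exists_leaf_of_adj_of_three_le hharm hr ha₃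
  have hb12 : b₁ ≠ b₂ := fun h => h12 ((hleaf₂ a₁).mp (h ▸ (hleaf₁ a₁).mpr rfl))
  have hb13 : b₁ ≠ b₃ := fun h => h13 ((hleaf₃ a₁).mp (h ▸ (hleaf₁ a₁).mpr rfl))
  have hb23 : b₂ ≠ b₃ := fun h => h23 ((hleaf₃ a₂).mp (h ▸ (hleaf₂ a₂).mpr rfl))
  have hne {x y : V} (h : G.degree x ≠ G.degree y) : x ≠ y := fun e => h (by rw [e])
  let f : Fin 7 → V := ![r, a₁, a₂, a₃, b₁, b₂, b₃]
  have hinj : Function.Injective f := by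
    have hnd : (List.ofFn f).Nodup := by
      simp only [f, List.ofFn_succ, List.ofFn_zero, Matrix.cons_val_zero, Matrix.cons_val_succ,
        List.nodup_cons, List.mem_cons, List.not_mem_nil, or_false, not_or, List.nodup_nil,
        not_false_eq_true, and_true]
      refine ⟨⟨?_, ?_, ?_, ?_, ?_, ?_⟩, ⟨h12, h13, ?_, ?_, ?_⟩, ⟨h23, ?_, ?_, ?_⟩, ⟨?_, ?_, ?_⟩,
        ⟨hb12, hb13⟩, hb23⟩ <;> exact hne (by omega)
    exact List.nodup_ofFn.mp hnd
  have hclosed : ∀ x y, G.Adj x y → x ∈ Set.range f → y ∈ Set.range f := by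
    rintro _ y hxy ⟨i, rfl⟩
    fin_cases i
    · rcases (hradj y).mp hxy with rfl | rfl | rfl
      exacts [⟨1, rfl⟩, ⟨2, rfl⟩, ⟨3, rfl⟩]
    · rcases (hadj₁ y).mp hxy with rfl | rfl
      exacts [⟨0, rfl⟩, ⟨4, rfl⟩]
    · rcases (hadj₂ y).mp hxy with rfl | rfl
      exacts [⟨0, rfl⟩, ⟨5, rfl⟩]
    · rcases (hadj₃ y).mp hxy with rfl | rfl
      exacts [⟨0, rfl⟩, ⟨6, rfl⟩]
    · exact ⟨1, ((hleaf₁ y).mp hxy).symm⟩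
    · exact ⟨2, ((hleaf₂ y).mp hxy).symm⟩
    · exact ⟨3, ((hleaf₃ y).mp hxy).symm⟩
  have hsurj : Function.Surjective f := fun x => by
    obtain ⟨p⟩ := hconn.preconnected r x
    have hp : ∀ {u w : V}, G.Walk u w → u ∈ Set.range f → w ∈ Set.range f := by
      intro u w p
      induction p with
      | nil => exact id
      | cons h _ ih => exact fun hu => ih (hclosed _ _ h hu)
    exact hp p ⟨0, rfl⟩
  have hf0 : ∀ j, G.Adj (f 0) (f j) ↔ f j = f 1 ∨ f j = f 2 ∨ f j = f 3 := fun j => hradj _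
  have hf1 : ∀ j, G.Adj (f 1) (f j) ↔ f j = f 0 ∨ f j = f 4 := fun j => hadj₁ _
  have hf2 : ∀ j, G.Adj (f 2) (f j) ↔ f j = f 0 ∨ f j = f 5 := fun j => hadj₂ _
  have hf3 : ∀ j, G.Adj (f 3) (f j) ↔ f j = f 0 ∨ f j = f 6 := fun j => hadj₃ _
  have hf4 : ∀ j, G.Adj (f 4) (f j) ↔ f j = f 1 := fun j => hleaf₁ _
  have hf5 : ∀ j, G.Adj (f 5) (f j) ↔ f j = f 2 := fun j => hleaf₂ _
  have hf6 : ∀ j, G.Adj (f 6) (f j) ↔ f j = f 3 := fun j => hleaf₃ _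
  simp only [hinj.eq_iff] at hf0 hf1 hf2 hf3 hf4 hf5 hf6
  have hadj : ∀ i j, G.Adj (f i) (f j) ↔ T2.Adj i j := by
    intro i j
    unfold T2
    fin_cases i
    · exact (hf0 j).trans (by revert j; decide)
    · exact (hf1 j).trans (by revert j; decide)
    · exact (hf2 j).trans (by revert j; decide)
    · exact (hf3 j).trans (by revert j; decide)
    · exact (hf4 j).trans (by revert j; decide)
    · exact (hf5 j).trans (by revert j; decide)
    · exact (hf6 j).trans (by revert j; decide)
  exact ⟨(⟨Equiv.ofBijective f ⟨hinj, hsurj⟩, hadj _ _⟩ : T2 ≃g G).symm⟩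
end

section
/- Let G be a finite simple graph with no isolated vertices and let ij be an edge of G with d_j ≤ m_i (as rationals). Then d_i ≤ m_i·(m_j − 1) + 1, with equality if and only if d_j = m_i and every neighbor of j other than i has degree 1. -/
open Finset

/-- A vertex of degree one has as average 2-degree the degree of its only neighbor. -/
theorem SimpleGraph.avgTwoDeg_eq_degree_of_degree_eq_one {V : Type*} [Fintype V]
    (G : SimpleGraph V) [DecidableRel G.Adj] {i j : V} (hij : G.Adj i j)
    (hi : G.degree i = 1) : G.avgTwoDeg i = G.degree j := by
  obtain ⟨k, hk⟩ := Finset.card_eq_one.mp ((G.card_neighborFinset_eq_degree i).trans hi)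
  obtain rfl : j = k := by
    have hj := (G.mem_neighborFinset i j).mpr hij
    rwa [hk, Finset.mem_singleton] at hj
  simp [SimpleGraph.avgTwoDeg, hk, hi]

/-- The sum of the degrees of the neighbors of `j`, with the neighbor `i` singled out. -/
theorem SimpleGraph.avgTwoDeg_mul_degree_of_adj {V : Type*} [Fintype V] [DecidableEq V]
    (G : SimpleGraph V) [DecidableRel G.Adj] {i j : V} (hij : G.Adj i j) :
    G.avgTwoDeg j * G.degree j = G.degree j + ((G.degree i : ℚ) - 1) +
      ∑ l ∈ (G.neighborFinset j).erase i, ((G.degree l : ℚ) - 1) := by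
  have hi : i ∈ G.neighborFinset j := (G.mem_neighborFinset j i).mpr hij.symm
  have hpos : (G.degree j : ℚ) ≠ 0 :=
    Nat.cast_ne_zero.mpr ((G.degree_pos_iff_exists_adj j).mpr ⟨i, hij.symm⟩).ne'
  rw [SimpleGraph.avgTwoDeg, div_mul_cancel₀ _ hpos, add_assoc,
    Finset.add_sum_erase _ (fun l => (G.degree l : ℚ) - 1) hi, Finset.sum_sub_distrib]
  simp

/-- If `ij` is an edge of a finite simple graph `G` with no isolated
vertices and `d_j ≤ m_i`, then `d_i ≤ m_i (m_j − 1) + 1`, with equality iff `d_j = m_i`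
and every neighbor of `j` other than `i` has degree `1`. -/
theorem deg_le_avgTwoDeg_mul {V : Type*} [Fintype V]
    (G : SimpleGraph V) [DecidableRel G.Adj]
    (hiso : ∀ v : V, 0 < G.degree v)
    (i j : V) (hij : G.Adj i j)
    (hdj : (G.degree j : ℚ) ≤ G.avgTwoDeg i) :
    (G.degree i : ℚ) ≤ G.avgTwoDeg i * (G.avgTwoDeg j - 1) + 1 ∧
    ((G.degree i : ℚ) = G.avgTwoDeg i * (G.avgTwoDeg j - 1) + 1 ↔
      ((G.degree j : ℚ) = G.avgTwoDeg i ∧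
        ∀ l : V, G.Adj j l → l ≠ i → G.degree l = 1)) := by
  classical
  have one_le (v : V) : (1 : ℚ) ≤ G.degree v := by exact_mod_cast hiso v
  have hS := G.avgTwoDeg_mul_degree_of_adj hij
  have leaf := G.avgTwoDeg_eq_degree_of_degree_eq_one hij
  have nonneg : ∀ l ∈ (G.neighborFinset j).erase i, (0 : ℚ) ≤ (G.degree l : ℚ) - 1 :=
    fun l _ => sub_nonneg.mpr (one_le l)
  have excess_nonneg := Finset.sum_nonneg nonneg
  have excess_eq_zero : ∑ l ∈ (G.neighborFinset j).erase i, ((G.degree l : ℚ) - 1) = 0 ↔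
      ∀ l : V, G.Adj j l → l ≠ i → G.degree l = 1 := by
    rw [Finset.sum_eq_zero_iff_of_nonneg nonneg]
    simp only [Finset.mem_erase, SimpleGraph.mem_neighborFinset, sub_eq_zero, Nat.cast_eq_one]
    exact ⟨fun h l hl hli => h l ⟨hli, hl⟩, fun h l hl => h l hl.2 hl.1⟩
  rw [← excess_eq_zero]
  have hi := one_le i
  have hj := one_le j
  rw [← Nat.cast_eq_one (R := ℚ)] at leaf
  generalize ∑ l ∈ (G.neighborFinset j).erase i, ((G.degree l : ℚ) - 1) = e at *
  generalize G.avgTwoDeg i = m at *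
  generalize G.avgTwoDeg j = n at *
  generalize (G.degree i : ℚ) = a at *
  generalize (G.degree j : ℚ) = d at *
  have key : d * (m * (n - 1) + 1 - a) = (m - d) * (a - 1) + m * e := by
    linear_combination m * hS
  have hd : 0 < d := by linarith
  have hm : 0 < m := by linarith
  have h₁ : 0 ≤ (m - d) * (a - 1) := mul_nonneg (by linarith) (by linarith)
  have h₂ : 0 ≤ m * e := mul_nonneg hm.le excess_nonneg
  refine ⟨?_, fun h => ?_, ?_⟩
  · exact sub_nonneg.mp (nonneg_of_mul_nonneg_right (key ▸ add_nonneg h₁ h₂) hd)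
  · rw [← h, sub_self, mul_zero] at key
    have he : m * e = 0 := by linarith
    have hma : (m - d) * (a - 1) = 0 := by linarith
    refine ⟨?_, (mul_eq_zero.mp he).resolve_left hm.ne'⟩
    rcases mul_eq_zero.mp hma with h' | h'
    · linarith
    · exact (leaf (by linarith)).symm
  · rintro ⟨rfl, rfl⟩
    linear_combination -hS
end

section
/- Let k ≥ 2 be an integer and let G be a connected finite simple graph with no isolated vertices such that m_i ≤ k for every vertex i (i.e., ∑_{j adjacent to i} d_j ≤ k·d_i for all i). Then the maximum degree of G satisfies Δ(G) ≤ k² − k + 1. -/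
open Finset

/-- In a graph without isolated vertices, the degrees of the neighbours of `j` other than a fixed
neighbour `i` contribute at least `d_j - 1` to the sum of the neighbouring degrees. -/
theorem degree_add_degree_le_sum_degree_add_one {V : Type*} [Fintype V]
    (G : SimpleGraph V) [DecidableRel G.Adj] (hiso : ∀ i : V, 0 < G.degree i)
    {i j : V} (hij : G.Adj j i) :
    G.degree i + G.degree j ≤ ∑ l ∈ G.neighborFinset j, G.degree l + 1 := by
  classical
  have hi : i ∈ G.neighborFinset j := (G.mem_neighborFinset j i).2 hij
  have hcard : #((G.neighborFinset j).erase i) + 1 = G.degree j := by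
    rw [card_erase_add_one hi, G.card_neighborFinset_eq_degree]
  have hle : #((G.neighborFinset j).erase i) ≤
      ∑ l ∈ (G.neighborFinset j).erase i, G.degree l := by
    simpa using card_nsmul_le_sum _ (fun l => G.degree l) 1 fun l _ => hiso l
  have hsum := add_sum_erase (G.neighborFinset j) (fun l => G.degree l) hi
  omega

/-- Let `k ≥ 2` and let `G` be a connected finite simple graph with no
isolated vertices such that `m_i ≤ k` for every vertex `i`
(i.e. `∑_{j ~ i} d_j ≤ k·d_i`). Then `Δ(G) ≤ k² − k + 1`. -/
theorem maxDegree_le_of_avgTwoDeg_le {V : Type*} [Fintype V]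
    (G : SimpleGraph V) [DecidableRel G.Adj] (k : ℕ) (hk : 2 ≤ k)
    (hconn : G.Connected)
    (hiso : ∀ i : V, 0 < G.degree i)
    (hm : ∀ i : V, ∑ j ∈ G.neighborFinset i, G.degree j ≤ k * G.degree i) :
    G.maxDegree ≤ k ^ 2 - k + 1 := by
  have := hconn.nonempty
  obtain ⟨i, hi⟩ := G.exists_maximal_degree_vertex
  obtain ⟨j, hj, hjk⟩ : ∃ j ∈ G.neighborFinset i, G.degree j ≤ k := by
    refine exists_le_of_sum_le (card_pos.1 (hiso i)) ?_
    simpa [mul_comm] using hm i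
  have hsum := degree_add_degree_le_sum_degree_add_one G hiso ((G.mem_neighborFinset i j).1 hj).symm
  have hmj := hm j
  rw [hi]
  obtain ⟨c, rfl⟩ : ∃ c, k = c + 1 := ⟨k - 1, by omega⟩
  have hmul := Nat.mul_le_mul_left c hjk
  have hsq : (c + 1) ^ 2 - (c + 1) = c * (c + 1) := by
    rw [Nat.sub_eq_iff_eq_add (Nat.le_self_pow two_ne_zero _)]
    ring
  rw [hsq]
  linarith
end

section
/- Let k ≥ 2 be an integer and let G be a connected finite simple graph with no isolated vertices such that m_i ≤ k for every vertex i. Then the maximum degree of G equals k² − k + 1 if and only if G has a vertex j with d_j = k and m_j = k (i.e., ∑_{l adjacent to j} d_l = k²) such that all neighbors of j have degree 1 with exactly one exception. -/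
open Finset

namespace SimpleGraph

variable {V : Type*} [Fintype V] (G : SimpleGraph V) [DecidableRel G.Adj]

/-- Splitting the neighbour-degree sum at `u` along an edge `u ~ v`. -/
lemma sum_degree_neighborFinset_erase_add [DecidableEq V] {u v : V} (h : G.Adj u v) :
    ∑ l ∈ G.neighborFinset u, G.degree l =
      ∑ l ∈ (G.neighborFinset u).erase v, G.degree l + G.degree v ∧
    #((G.neighborFinset u).erase v) + 1 = G.degree u := by
  have hv : v ∈ G.neighborFinset u := (G.mem_neighborFinset u v).2 h
  exact ⟨(Finset.sum_erase_add _ _ hv).symm, Finset.card_erase_add_one hv⟩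

lemma degree_add_degree_le_sum_add_one (hiso : ∀ i, 0 < G.degree i) {u v : V} (h : G.Adj u v) :
    G.degree v + G.degree u ≤ ∑ l ∈ G.neighborFinset u, G.degree l + 1 := by
  classical
  obtain ⟨hsum, hcard⟩ := G.sum_degree_neighborFinset_erase_add h
  have := Finset.card_nsmul_le_sum ((G.neighborFinset u).erase v) (fun l ↦ G.degree l) 1
    fun l _ ↦ Nat.succ_le_of_lt (hiso l)
  rw [smul_eq_mul, mul_one] at this
  omega

lemma degree_eq_one_of_sum_add_one_le (hiso : ∀ i, 0 < G.degree i) {u v : V} (h : G.Adj u v)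
    (hle : ∑ l ∈ G.neighborFinset u, G.degree l + 1 ≤ G.degree v + G.degree u)
    {l : V} (hl : G.Adj u l) (hlv : l ≠ v) : G.degree l = 1 := by
  classical
  obtain ⟨hsum, hcard⟩ := G.sum_degree_neighborFinset_erase_add h
  by_contra hne
  have hlt : ∑ _l ∈ (G.neighborFinset u).erase v, 1 <
      ∑ l ∈ (G.neighborFinset u).erase v, G.degree l :=
    Finset.sum_lt_sum (fun i _ ↦ hiso i)
      ⟨l, Finset.mem_erase.2 ⟨hlv, (G.mem_neighborFinset u l).2 hl⟩, by have := hiso l; omega⟩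
  rw [← Finset.card_eq_sum_ones] at hlt
  omega

lemma exists_adj_degree_le {k : ℕ} {v : V} (hv : 0 < G.degree v)
    (hm : ∑ j ∈ G.neighborFinset v, G.degree j ≤ k * G.degree v) :
    ∃ u, G.Adj v u ∧ G.degree u ≤ k := by
  obtain ⟨u, hu, huk⟩ := Finset.exists_le_of_sum_le (s := G.neighborFinset v)
    (f := fun j ↦ G.degree j) (g := fun _ ↦ k) (Finset.card_pos.1 hv)
    (by simpa [mul_comm] using hm)
  exact ⟨u, (G.mem_neighborFinset v u).1 hu, huk⟩

end SimpleGraph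

/-- Let `k ≥ 2` and let `G` be a connected finite simple graph with no
isolated vertices such that `m_i ≤ k` for every vertex `i`. Then `Δ(G) = k² − k + 1`
iff `G` has a vertex `j` with `d_j = k` and `m_j = k` (i.e. `∑_{l ~ j} d_l = k²`)
all of whose neighbors have degree `1` with exactly one exception. -/
theorem maxDegree_eq_iff_of_avgTwoDeg_le {V : Type*} [Fintype V]
    (G : SimpleGraph V) [DecidableRel G.Adj] (k : ℕ) (hk : 2 ≤ k)
    (hconn : G.Connected)
    (hiso : ∀ i : V, 0 < G.degree i)
    (hm : ∀ i : V, ∑ j ∈ G.neighborFinset i, G.degree j ≤ k * G.degree i) :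
    G.maxDegree = k ^ 2 - k + 1 ↔
      ∃ j : V, G.degree j = k ∧ (∑ l ∈ G.neighborFinset j, G.degree l) = k ^ 2 ∧
        ∃ i : V, G.Adj j i ∧ G.degree i ≠ 1 ∧
          ∀ l : V, G.Adj j l → l ≠ i → G.degree l = 1 := by
  obtain ⟨n, rfl⟩ : ∃ n, k = n + 1 := ⟨k - 1, by omega⟩
  have hn : 1 ≤ n := by omega
  have hD : (n + 1) ^ 2 - (n + 1) + 1 = n * (n + 1) + 1 := by
    rw [show (n + 1) ^ 2 = n * (n + 1) + (n + 1) by ring, Nat.add_sub_cancel]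
  have key {u v : V} (h : G.Adj u v) : G.degree v ≤ n * G.degree u + 1 := by
    have h₁ := G.degree_add_degree_le_sum_add_one hiso h
    have h₂ := hm u
    rw [Nat.succ_mul] at h₂
    omega
  rw [hD]
  constructor
  · intro hmax
    have := hconn.nonempty
    obtain ⟨v, hv⟩ := G.exists_maximal_degree_vertex
    obtain ⟨u, hvu, huk⟩ := G.exists_adj_degree_le (hiso v) (hm v)
    have hku : n + 1 ≤ G.degree u := by
      have := key hvu.symm
      exact le_of_mul_le_mul_left (by omega : n * (n + 1) ≤ n * G.degree u) hn
    have hu : G.degree u = n + 1 := le_antisymm huk hku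
    have hle := hm u
    have hge := G.degree_add_degree_le_sum_add_one hiso hvu.symm
    rw [hu] at hle hge
    have hsq : (n + 1) * (n + 1) = n * (n + 1) + (n + 1) := by ring
    refine ⟨u, hu, by rw [pow_two]; omega, v, hvu.symm, ?_, fun l hl hlv ↦
      G.degree_eq_one_of_sum_add_one_le hiso hvu.symm (by omega) hl hlv⟩
    have : 0 < n * (n + 1) := by positivity
    omega
  · classical
    rintro ⟨j, hj, hsum, i, hji, -, hl⟩
    apply le_antisymm
    · refine G.maxDegree_le_of_forall_degree_le _ fun v ↦ ?_
      obtain ⟨u, hvu, huk⟩ := G.exists_adj_degree_le (hiso v) (hm v)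
      exact (key hvu.symm).trans (by gcongr)
    · obtain ⟨hsplit, hcard⟩ := G.sum_degree_neighborFinset_erase_add hji
      have hones : ∑ l ∈ (G.neighborFinset j).erase i, G.degree l =
          #((G.neighborFinset j).erase i) := by
        rw [Finset.card_eq_sum_ones]
        refine Finset.sum_congr rfl fun l h ↦ ?_
        rw [Finset.mem_erase, SimpleGraph.mem_neighborFinset] at h
        exact hl l h.2 h.1
      have hsq : (n + 1) ^ 2 = n * (n + 1) + (n + 1) := by ring
      exact le_trans (by omega) (G.degree_le_maxDegree i)
end

section
/- Let k ≥ 3 be an integer and let G be a pseudo k-regular finite simple graph. Let ij be an edge of G such that 2 ≤ d_j < k. Then 2 ≤ d_i ≤ k² − 3k + 4, and d_i = k² − 3k + 4 holds if and only if d_j = k − 1 and every neighbor of j other than i has degree 2. -/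
open Finset

/-- `G` is pseudo `k`-regular: it has no isolated vertices, it is `k`-harmonic
(`∑_{j ~ i} d_j = k·d_i` for all `i`, i.e. `m_i = k`), and it is not regular. -/
def SimpleGraph.IsPseudoRegular {V : Type*} [Fintype V]
    (G : SimpleGraph V) [DecidableRel G.Adj] (k : ℕ) : Prop :=
  (∀ i : V, 0 < G.degree i) ∧
  (∀ i : V, ∑ j ∈ G.neighborFinset i, G.degree j = k * G.degree i) ∧
  ¬ ∃ d : ℕ, ∀ i : V, G.degree i = d

/-- In a `k`-harmonic graph without isolated vertices, a neighbor of a vertex of degree less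
than `k` has degree at least `2`. -/
lemma SimpleGraph.two_le_degree_of_adj_of_degree_lt {V : Type*} [Fintype V]
    (G : SimpleGraph V) [DecidableRel G.Adj] {k : ℕ}
    (hharm : ∀ i : V, ∑ j ∈ G.neighborFinset i, G.degree j = k * G.degree i)
    {j l : V} (hjl : G.Adj j l) (hjk : G.degree j < k) : 2 ≤ G.degree l := by
  have hmem : j ∈ G.neighborFinset l := by simpa using hjl.symm
  have hpos : 0 < G.degree l := (G.degree_pos_iff_exists_adj l).2 ⟨j, hjl.symm⟩
  by_contra! hlt
  have hone : G.degree l = 1 := by omega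
  obtain ⟨a, ha⟩ := Finset.card_eq_one.1 ((G.card_neighborFinset_eq_degree l).trans hone)
  have hsum := hharm l
  rw [ha, Finset.mem_singleton] at hmem
  subst hmem
  rw [ha, Finset.sum_singleton, hone] at hsum
  omega

/-- Let `k ≥ 3`, `G` pseudo `k`-regular and `ij` an edge with
`2 ≤ d_j < k`. Then `2 ≤ d_i ≤ k² − 3k + 4`, with `d_i = k² − 3k + 4` iff `d_j = k − 1`
and every neighbor of `j` other than `i` has degree `2`. -/
theorem deg_le_of_pseudoRegular_edge {V : Type*} [Fintype V]
    (G : SimpleGraph V) [DecidableRel G.Adj] (k : ℕ) (hk : 3 ≤ k)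
    (hG : G.IsPseudoRegular k)
    (i j : V) (hij : G.Adj i j) (hj2 : 2 ≤ G.degree j) (hjk : G.degree j < k) :
    2 ≤ G.degree i ∧ G.degree i ≤ k ^ 2 - 3 * k + 4 ∧
    (G.degree i = k ^ 2 - 3 * k + 4 ↔
      (G.degree j = k - 1 ∧ ∀ l : V, G.Adj j l → l ≠ i → G.degree l = 2)) := by
  classical
  obtain ⟨-, hharm, -⟩ := hG
  have hge : ∀ l, G.Adj j l → 2 ≤ G.degree l := fun l hl =>
    G.two_le_degree_of_adj_of_degree_lt hharm hl hjk
  have hmem : i ∈ G.neighborFinset j := by simpa using hij.symm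
  set s := (G.neighborFinset j).erase i with hs
  have hcard : #s + 1 = G.degree j := by
    rw [hs, Finset.card_erase_add_one hmem, G.card_neighborFinset_eq_degree]
  have hsum : ∑ l ∈ s, G.degree l + G.degree i = k * G.degree j := by
    rw [hs, Finset.sum_erase_add _ _ hmem, hharm]
  have hs2 : ∀ l ∈ s, 2 ≤ G.degree l := fun l hl =>
    hge l (by simpa using Finset.mem_of_mem_erase hl)
  have hconst : ∑ _l ∈ s, 2 = 2 * #s := by simp [mul_comm]
  have hle : 2 * #s ≤ ∑ l ∈ s, G.degree l := hconst ▸ Finset.sum_le_sum hs2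
  have heq : 2 * #s = ∑ l ∈ s, G.degree l ↔ ∀ l, G.Adj j l → l ≠ i → G.degree l = 2 := by
    rw [← hconst, Finset.sum_eq_sum_iff_of_le hs2]
    simp only [hs, Finset.mem_erase, SimpleGraph.mem_neighborFinset, and_imp]
    exact ⟨fun h l hl hne => (h l hne hl).symm, fun h l hne hl => (h l hl hne).symm⟩
  rw [← heq]
  obtain ⟨m, rfl⟩ := Nat.exists_eq_add_of_le hk
  have hbound : (3 + m) ^ 2 - 3 * (3 + m) + 4 = (m + 1) * (m + 2) + 2 := by
    have h : (3 + m) ^ 2 = 3 * (3 + m) + (m ^ 2 + 3 * m) := by ring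
    rw [h, Nat.add_sub_cancel_left]
    ring
  obtain ⟨e, he⟩ := Nat.exists_eq_add_of_le (show G.degree j ≤ m + 2 by omega)
  have hkey : G.degree i + (∑ l ∈ s, G.degree l - 2 * #s) + (m + 1) * e
      = (m + 1) * (m + 2) + 2 := by
    zify [hle] at *
    rw [he]
    linear_combination hsum - 2 * hcard
  have hme : e ≤ (m + 1) * e := Nat.le_mul_of_pos_left e m.succ_pos
  rw [hbound]
  refine ⟨hge i hij.symm, by omega, fun h => by omega, fun ⟨h₁, h₂⟩ => ?_⟩
  obtain rfl : e = 0 := by omega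
  omega
end

section
/- Let k ≥ 3 be an integer and let G be a pseudo k-regular finite simple graph with a vertex i of degree d_i ≥ k² − 3k + 5. Then every neighbor j of i has degree d_j = k. -/
open Finset

/-- In a `k`-harmonic graph, the neighbor of a vertex of degree one has degree `k`. -/
theorem SimpleGraph.degree_eq_of_adj_of_degree_eq_one {V : Type*} [Fintype V]
    (G : SimpleGraph V) [DecidableRel G.Adj] {k : ℕ}
    (hk : ∀ i : V, ∑ j ∈ G.neighborFinset i, G.degree j = k * G.degree i)
    {h j : V} (hadj : G.Adj h j) (hdeg : G.degree h = 1) : G.degree j = k := by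
  obtain ⟨x, hx⟩ := Finset.card_eq_one.mp ((G.card_neighborFinset_eq_degree h).trans hdeg)
  have hj : j ∈ G.neighborFinset h := (G.mem_neighborFinset h j).mpr hadj
  have hsum := hk h
  rw [hx, Finset.mem_singleton] at hj
  subst hj
  simpa [hx, hdeg] using hsum

/-- In a `k`-harmonic graph, if `c` bounds from below the degrees of the neighbors of `j`
other than `i`, then `d_i + c (d_j - 1) ≤ k d_j`. -/
theorem SimpleGraph.degree_add_mul_le_of_adj {V : Type*} [Fintype V]
    (G : SimpleGraph V) [DecidableRel G.Adj] {k c : ℕ}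
    (hk : ∀ i : V, ∑ j ∈ G.neighborFinset i, G.degree j = k * G.degree i)
    {i j : V} (hadj : G.Adj i j) (hc : ∀ h, G.Adj j h → c ≤ G.degree h) :
    G.degree i + (G.degree j - 1) * c ≤ k * G.degree j := by
  classical
  have hi : i ∈ G.neighborFinset j := (G.mem_neighborFinset j i).mpr hadj.symm
  rw [← hk j, ← Finset.add_sum_erase _ _ hi, ← G.card_neighborFinset_eq_degree j,
    ← Finset.card_erase_of_mem hi, ← smul_eq_mul]
  gcongr
  refine Finset.card_nsmul_le_sum _ _ _ fun h hh => hc h ?_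
  exact (G.mem_neighborFinset j h).mp (Finset.mem_of_mem_erase hh)

/-- Let `k ≥ 3` and let `G` be pseudo `k`-regular with a vertex `i`
of degree `d_i ≥ k² − 3k + 5`. Then every neighbor `j` of `i` has degree `d_j = k`. -/
theorem neighbor_deg_eq_of_large_deg {V : Type*} [Fintype V]
    (G : SimpleGraph V) [DecidableRel G.Adj] (k : ℕ) (hk : 3 ≤ k)
    (hG : G.IsPseudoRegular k)
    (i : V) (hi : k ^ 2 - 3 * k + 5 ≤ G.degree i) :
    ∀ j : V, G.Adj i j → G.degree j = k := by
  obtain ⟨hpos, hharm, -⟩ := hG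
  obtain ⟨m, rfl⟩ := Nat.exists_eq_add_of_le hk
  have hi' : m * m + 3 * m + 5 ≤ G.degree i := by
    have : (3 + m) ^ 2 - 3 * (3 + m) = m * m + 3 * m := by
      rw [Nat.sub_eq_iff_eq_add (by nlinarith)]; ring
    omega
  have hge : ∀ j, G.Adj i j → 3 + m ≤ G.degree j := by
    intro j hj
    by_contra! hlt
    have h1 := G.degree_add_mul_le_of_adj hharm hj fun h _ => hpos h
    have hjpos := hpos j
    obtain ⟨e, he⟩ : ∃ e, G.degree j = e + 1 := ⟨_, (Nat.succ_pred_eq_of_pos hjpos).symm⟩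
    have hdeg : G.degree j = m + 2 := by
      have : m + 1 ≤ e := by
        rw [he] at h1
        simp only [Nat.add_sub_cancel] at h1
        by_contra! hem
        nlinarith [Nat.mul_le_mul_left m (Nat.le_of_lt_succ hem)]
      omega
    have htwo : ∀ h, G.Adj j h → 2 ≤ G.degree h := by
      intro h hh
      by_contra! hlt2
      have hone : G.degree h = 1 := by have := hpos h; omega
      have := G.degree_eq_of_adj_of_degree_eq_one hharm hh.symm hone
      omega
    have h2 := G.degree_add_mul_le_of_adj hharm hj htwo
    rw [hdeg] at h2
    simp only [show m + 2 - 1 = m + 1 from rfl] at h2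
    nlinarith
  have hsum : ∑ _j ∈ G.neighborFinset i, (3 + m) = ∑ j ∈ G.neighborFinset i, G.degree j := by
    rw [hharm, Finset.sum_const, G.card_neighborFinset_eq_degree, smul_eq_mul, mul_comm]
  intro j hj
  exact ((Finset.sum_eq_sum_iff_of_le fun x hx => hge x ((G.mem_neighborFinset i x).mp hx)).mp
    hsum j ((G.mem_neighborFinset i j).mpr hj)).symm
end

section
/- Let k ≥ 3 be an integer and let G be a pseudo k-regular finite simple graph on n vertices with a vertex i of degree d_i ≥ k² − 3k + 5. Then n ≥ ⌈(5k⁴ − 31k³ + 94k² − 140k + 100)/k²⌉; equivalently, n·k² ≥ 5k⁴ − 31k³ + 94k² − 140k + 100. -/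
open Finset

namespace SimpleGraph

variable {V : Type*} [Fintype V] (G : SimpleGraph V) [DecidableRel G.Adj]

/-- The number of common neighbours of `i` and `w`, as an integer. -/
def codegree (i w : V) : ℤ := ∑ j ∈ G.neighborFinset i, if G.Adj j w then 1 else 0

theorem sum_codegree_mul (i : V) (f : V → ℤ) :
    ∑ w, G.codegree i w * f w = ∑ j ∈ G.neighborFinset i, ∑ w ∈ G.neighborFinset j, f w := by
  simp only [codegree, sum_mul, ite_mul, one_mul, zero_mul]
  rw [sum_comm]
  refine sum_congr rfl fun j _ => ?_
  rw [neighborFinset_eq_filter, sum_filter]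

theorem codegree_nonneg (i w : V) : 0 ≤ G.codegree i w :=
  sum_nonneg fun j _ => by split_ifs <;> simp

theorem codegree_le_degree (i w : V) : G.codegree i w ≤ G.degree w := by
  have h : G.codegree i w ≤ ∑ j, if G.Adj w j then (1 : ℤ) else 0 := by
    simp only [codegree, G.adj_comm w]
    exact sum_le_sum_of_subset_of_nonneg (subset_univ _) fun j _ _ => by split_ifs <;> simp
  rwa [← sum_filter, ← neighborFinset_eq_filter, sum_const, card_neighborFinset_eq_degree,
    nsmul_one] at h

theorem codegree_self (i : V) : G.codegree i i = G.degree i := by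
  rw [codegree, sum_congr rfl fun j hj => if_pos ((G.mem_neighborFinset i j).1 hj).symm]
  simp

theorem exists_adj_adj_of_codegree_ne_zero {i w : V} (h : G.codegree i w ≠ 0) :
    ∃ j, G.Adj i j ∧ G.Adj j w := by
  obtain ⟨j, hj, hne⟩ := exists_ne_zero_of_sum_ne_zero h
  exact ⟨j, (G.mem_neighborFinset i j).1 hj, by by_contra hn; simp [hn] at hne⟩

variable {G} {k : ℕ}

theorem sum_degree_sub_one (hG : G.IsPseudoRegular k) (w : V) :
    ∑ j ∈ G.neighborFinset w, ((G.degree j : ℤ) - 1) = (k - 1) * G.degree w := by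
  have h : ∑ j ∈ G.neighborFinset w, (G.degree j : ℤ) = k * G.degree w := by
    exact_mod_cast hG.2.1 w
  rw [sum_sub_distrib, h]
  simp
  ring

theorem sum_sub_one_le (hG : G.IsPseudoRegular k) {w : V} {s : Finset V}
    (hs : s ⊆ G.neighborFinset w) :
    ∑ j ∈ s, ((G.degree j : ℤ) - 1) ≤ (k - 1) * G.degree w := by
  rw [← sum_degree_sub_one hG]
  refine sum_le_sum_of_subset_of_nonneg hs fun j _ _ => ?_
  have := hG.1 j
  lia

theorem sub_one_le_degree (hG : G.IsPseudoRegular k) (hk : 3 ≤ k) {i w : V}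
    (hi : (k : ℤ) ^ 2 - 3 * k + 5 ≤ G.degree i) (hw : G.Adj i w) :
    (k : ℤ) - 1 ≤ G.degree w := by
  have h := sum_sub_one_le hG (w := w) (s := {i}) (by simpa using hw.symm)
  rw [sum_singleton] at h
  have hk' : (3 : ℤ) ≤ k := by exact_mod_cast hk
  by_contra! hlt
  nlinarith

theorem le_degree_of_triangle (hG : G.IsPseudoRegular k) (hk : 3 ≤ k) {i j w : V}
    (hi : (k : ℤ) ^ 2 - 3 * k + 5 ≤ G.degree i) (hw : G.Adj i w) (hj : G.Adj i j)
    (hjw : G.Adj j w) : (k : ℤ) ≤ G.degree w := by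
  classical
  have h := sum_sub_one_le hG (w := w) (s := {i, j})
    (by simp [insert_subset_iff, hw.symm, hjw.symm])
  rw [sum_pair hj.ne] at h
  have hd := sub_one_le_degree hG hk hi hj
  have hk' : (3 : ℤ) ≤ k := by exact_mod_cast hk
  by_contra! hlt
  nlinarith

theorem sum_codegree_mul_sub_degree (hG : G.IsPseudoRegular k) (i : V) :
    ∑ w, G.codegree i w * ((k : ℤ) - G.degree w) = 0 := by
  rw [sum_codegree_mul]
  refine sum_eq_zero fun j _ => ?_
  have h : ∑ w ∈ G.neighborFinset j, (G.degree w : ℤ) = k * G.degree j := by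
    exact_mod_cast hG.2.1 j
  rw [sum_sub_distrib, h]
  simp
  ring

theorem IsPseudoRegular.four_mul_degree_mul_le (hG : G.IsPseudoRegular k) (hk : 3 ≤ k) (i : V)
    (hi : (k : ℤ) ^ 2 - 3 * k + 5 ≤ G.degree i) :
    4 * (G.degree i : ℤ) * (G.degree i - k) ≤
      (Fintype.card V - 1 - G.degree i) * (k : ℤ) ^ 2 := by
  classical
  have hle : ∀ w, 4 * (G.codegree i w * ((k : ℤ) - G.degree w)) ≤
      (k : ℤ) ^ 2 - (if G.Adj i w then (k : ℤ) ^ 2 else 0) -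
        (if i = w then (k : ℤ) ^ 2 + 4 * G.degree i * (G.degree i - k) else 0) := by
    intro w
    have h0 := G.codegree_nonneg i w
    by_cases hiw : i = w
    · subst hiw
      simp [G.codegree_self]
      nlinarith
    by_cases hadj : G.Adj i w
    · simp only [hadj, hiw, if_true, if_false]
      rcases eq_or_ne (G.codegree i w) 0 with hc | hc
      · simp [hc]
      · obtain ⟨j, hj, hjw⟩ := G.exists_adj_adj_of_codegree_ne_zero hc
        nlinarith [le_degree_of_triangle hG hk hi hadj hj hjw]
    · simp only [hadj, hiw, if_false]
      nlinarith [G.codegree_le_degree i w, sq_nonneg ((k : ℤ) - 2 * G.codegree i w)]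
  have h := sum_le_sum fun w (_ : w ∈ univ) => hle w
  rw [← mul_sum, sum_codegree_mul_sub_degree hG, sum_sub_distrib, sum_sub_distrib,
    sum_ite_eq univ i, ← sum_filter, ← neighborFinset_eq_filter] at h
  simp only [sum_const, card_univ, card_neighborFinset_eq_degree, mem_univ, if_true,
    nsmul_eq_mul] at h
  linarith

end SimpleGraph

/-- Let `k ≥ 3` and let `G` be pseudo `k`-regular on `n` vertices with
a vertex `i` of degree `d_i ≥ k² − 3k + 5`. Then
`n ≥ ⌈(5k⁴ − 31k³ + 94k² − 140k + 100)/k²⌉`; equivalently,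
`n·k² ≥ 5k⁴ − 31k³ + 94k² − 140k + 100`. -/
theorem card_ge_of_large_deg {V : Type*} [Fintype V]
    (G : SimpleGraph V) [DecidableRel G.Adj] (k : ℕ) (hk : 3 ≤ k)
    (hG : G.IsPseudoRegular k)
    (i : V) (hi : k ^ 2 - 3 * k + 5 ≤ G.degree i) :
    (⌈(5 * (k : ℚ) ^ 4 - 31 * (k : ℚ) ^ 3 + 94 * (k : ℚ) ^ 2 - 140 * (k : ℚ) + 100) /
        (k : ℚ) ^ 2⌉ ≤ (Fintype.card V : ℤ)) ∧
    5 * (k : ℤ) ^ 4 - 31 * (k : ℤ) ^ 3 + 94 * (k : ℤ) ^ 2 - 140 * (k : ℤ) + 100 ≤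
      (Fintype.card V : ℤ) * (k : ℤ) ^ 2 := by
  have hk' : (3 : ℤ) ≤ k := by exact_mod_cast hk
  have hD : (k : ℤ) ^ 2 - 3 * k + 5 ≤ G.degree i := by
    have : k ^ 2 + 5 ≤ G.degree i + 3 * k := by lia
    zify at this
    linarith
  have key := hG.four_mul_degree_mul_le hk i hD
  have main : 5 * (k : ℤ) ^ 4 - 31 * (k : ℤ) ^ 3 + 94 * (k : ℤ) ^ 2 - 140 * (k : ℤ) + 100 ≤
      (Fintype.card V : ℤ) * (k : ℤ) ^ 2 := by
    obtain ⟨e, he⟩ : ∃ e : ℤ, (G.degree i : ℤ) = (k : ℤ) ^ 2 - 3 * k + 5 + e :=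
      ⟨G.degree i - ((k : ℤ) ^ 2 - 3 * k + 5), by ring⟩
    have he0 : 0 ≤ e := by linarith
    rw [he] at key
    have h1 : 0 ≤ e * (9 * (k : ℤ) ^ 2 - 28 * k + 40 + 4 * e) :=
      mul_nonneg he0 (by nlinarith)
    linarith
  refine ⟨?_, main⟩
  have hk0 : (0 : ℚ) < (k : ℚ) ^ 2 := by positivity
  rw [Int.ceil_le, div_le_iff₀ hk0]
  exact_mod_cast main
end

section
/- Let G be a connected pseudo 3-regular finite simple graph on n vertices with maximum degree 4, and for j = 1, 2, 3, 4 let a_j denote the number of vertices of G of degree j. Then: (i) a_1 + a_2 = 2·a_4; (ii) n = a_3 + 3·a_4; (iii) a_1 ≤ a_3; and (iv) a_1, a_2, a_3 all have the same parity. -/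
open Finset

namespace SimpleGraph

variable {V : Type*} [Fintype V] (G : SimpleGraph V) [DecidableRel G.Adj]

theorem sum_sum_neighborFinset_degree :
    ∑ i, ∑ j ∈ G.neighborFinset i, G.degree j = ∑ i, G.degree i * G.degree i := by
  rw [Finset.sum_comm' (t' := Finset.univ) (s' := fun j => G.neighborFinset j)
    (fun i j => by simp [G.adj_comm])]
  simp

variable {G}

/-- A weighted degree sum can be computed by grouping the vertices by degree. -/
theorem sum_comp_degree_of_degree_mem_Icc (hd : ∀ i, G.degree i ∈ Finset.Icc 1 4) (f : ℕ → ℕ) :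
    ∑ i, f (G.degree i) =
      ∑ d ∈ Finset.Icc 1 4, (Finset.univ.filter fun i => G.degree i = d).card * f d := by
  rw [← Finset.sum_fiberwise_of_maps_to (fun i _ => hd i)]
  refine Finset.sum_congr rfl fun d _ => ?_
  rw [Finset.sum_congr rfl fun i hi => by rw [(Finset.mem_filter.1 hi).2], Finset.sum_const,
    smul_eq_mul]

/-- A vertex of degree `3` whose neighbours have degree sum `9`, in a graph of maximum degree
at most `4`, has at most one pendant neighbour. -/
theorem eq_of_adj_of_degree_eq_one (hmax : ∀ i, G.degree i ≤ 4) {v x y : V}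
    (hv : G.degree v = 3) (hsum : ∑ j ∈ G.neighborFinset v, G.degree j = 9)
    (hvx : G.Adj v x) (hvy : G.Adj v y) (hx : G.degree x = 1) (hy : G.degree y = 1) :
    x = y := by
  classical
  by_contra hxy
  have hxm : x ∈ G.neighborFinset v := by simpa using hvx
  have hym : y ∈ (G.neighborFinset v).erase x := by simpa using ⟨Ne.symm hxy, hvy⟩
  rw [← Finset.add_sum_erase _ _ hxm, ← Finset.add_sum_erase _ _ hym, hx, hy] at hsum
  have hle := Finset.sum_le_card_nsmul (((G.neighborFinset v).erase x).erase y)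
    (fun j => G.degree j) 4 fun j _ => hmax j
  rw [Finset.card_erase_of_mem hym, Finset.card_erase_of_mem hxm, card_neighborFinset_eq_degree,
    hv, smul_eq_mul] at hle
  omega

theorem card_degree_one_le_card_degree_three (hmax : ∀ i, G.degree i ≤ 4)
    (hharm : ∀ i, ∑ j ∈ G.neighborFinset i, G.degree j = 3 * G.degree i) :
    (Finset.univ.filter fun i => G.degree i = 1).card ≤
      (Finset.univ.filter fun i => G.degree i = 3).card := by
  refine Finset.card_le_card_of_forall_subsingleton (fun x v => G.Adj v x) ?_ ?_
  · intro x hx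
    have hx : G.degree x = 1 := by simpa using hx
    obtain ⟨v, hv⟩ := Finset.card_eq_one.1 ((G.card_neighborFinset_eq_degree x).trans hx)
    have hadj : G.Adj x v := by
      rw [← mem_neighborFinset, hv]
      exact Finset.mem_singleton_self v
    have hsum := hharm x
    rw [hv, Finset.sum_singleton, hx] at hsum
    exact ⟨v, by simpa using hsum, hadj.symm⟩
  · rintro v hv x ⟨hx, hvx⟩ y ⟨hy, hvy⟩
    have hv : G.degree v = 3 := by simpa using hv
    exact eq_of_adj_of_degree_eq_one hmax hv (by rw [hharm, hv]) hvx hvy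
      (by simpa using hx) (by simpa using hy)

end SimpleGraph

/-- Let `G` be a connected pseudo `3`-regular graph on `n` vertices
with maximum degree `4`, and let `a j` be the number of vertices of degree `j`. Then
(i) `a₁ + a₂ = 2·a₄`; (ii) `n = a₃ + 3·a₄`; (iii) `a₁ ≤ a₃`; and
(iv) `a₁, a₂, a₃` all have the same parity. -/
theorem pseudo_three_regular_degree_counts {V : Type*} [Fintype V]
    (G : SimpleGraph V) [DecidableRel G.Adj]
    (hconn : G.Connected)
    (hG : G.IsPseudoRegular 3)
    (hmax : G.maxDegree = 4)
    (a : ℕ → ℕ)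
    (ha : ∀ j : ℕ, a j = (Finset.univ.filter (fun i : V => G.degree i = j)).card) :
    a 1 + a 2 = 2 * a 4 ∧
    Fintype.card V = a 3 + 3 * a 4 ∧
    a 1 ≤ a 3 ∧
    (a 1 % 2 = a 2 % 2 ∧ a 2 % 2 = a 3 % 2) := by
  obtain ⟨hpos, hharm, -⟩ := hG
  have hle : ∀ i, G.degree i ≤ 4 := fun i => hmax ▸ G.degree_le_maxDegree i
  have hd : ∀ i, G.degree i ∈ Finset.Icc 1 4 := fun i => Finset.mem_Icc.2 ⟨hpos i, hle i⟩
  have hsq : ∑ i, G.degree i * G.degree i = 3 * ∑ i, G.degree i := by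
    rw [← G.sum_sum_neighborFinset_degree, Finset.mul_sum]
    exact Finset.sum_congr rfl fun i _ => hharm i
  have hhand := G.sum_degrees_eq_twice_card_edges
  have hcard : Fintype.card V = ∑ _i : V, 1 := by simp
  have hleaf := SimpleGraph.card_degree_one_le_card_degree_three hle hharm
  have hIcc : Finset.Icc 1 4 = {1, 2, 3, 4} := by decide
  rw [SimpleGraph.sum_comp_degree_of_degree_mem_Icc hd fun d => d * d,
    SimpleGraph.sum_comp_degree_of_degree_mem_Icc hd fun d => d] at hsq
  rw [SimpleGraph.sum_comp_degree_of_degree_mem_Icc hd fun d => d] at hhand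
  rw [SimpleGraph.sum_comp_degree_of_degree_mem_Icc hd fun _ => 1] at hcard
  simp only [← ha, hIcc] at hsq hhand hcard hleaf
  simp at hsq hhand hcard
  omega
end

section
/- Let k ≥ 2 be an integer. Then every pseudo k-regular finite simple graph has at least k + 3 vertices; in particular, there is no pseudo k-regular graph on k + 2 or fewer vertices. -/
open Finset

namespace SimpleGraph

variable {V : Type*} [Fintype V] {G : SimpleGraph V} [DecidableRel G.Adj]

/-- In a `k`-harmonic graph, the excesses `d_j - k` of the neighbours of a vertex sum to zero. -/
theorem sum_neighborFinset_degree_sub_eq_zero {k : ℕ} {i : V}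
    (h : ∑ j ∈ G.neighborFinset i, G.degree j = k * G.degree i) :
    ∑ j ∈ G.neighborFinset i, ((G.degree j : ℤ) - k) = 0 := by
  rw [Finset.sum_sub_distrib, Finset.sum_const, card_neighborFinset_eq_degree, nsmul_eq_mul,
    ← Nat.cast_sum, h]
  push_cast
  ring

/-- A pseudo `k`-regular graph has a vertex of degree greater than `k`. -/
theorem IsPseudoRegular.exists_lt_degree {k : ℕ} (hG : G.IsPseudoRegular k) :
    ∃ v, k < G.degree v := by
  obtain ⟨hpos, hsum, hreg⟩ := hG
  by_contra! hle
  refine hreg ⟨k, fun j => ?_⟩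
  obtain ⟨i, hi⟩ := (G.degree_pos_iff_exists_adj j).1 (hpos j)
  have hz := sum_neighborFinset_degree_sub_eq_zero (hsum i)
  rw [Finset.sum_eq_zero_iff_of_nonpos fun l _ => by have := hle l; lia] at hz
  have := hz j (by simpa using hi.symm)
  lia

/-- A vertex with a non-neighbour other than itself is not dominating. -/
theorem degree_add_one_lt_card_of_not_adj {i j : V} (hne : i ≠ j) (h : ¬ G.Adj i j) :
    G.degree i + 1 < Fintype.card V := by
  classical
  have hsub : G.neighborFinset i ⊆ (univ.erase i).erase j := by
    intro l hl
    rw [mem_neighborFinset] at hl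
    simp only [mem_erase, mem_univ, and_true]
    exact ⟨fun hlj => h (hlj ▸ hl), hl.ne'⟩
  have hcard := Finset.card_le_card hsub
  rw [card_neighborFinset_eq_degree, card_erase_of_mem (by simpa using hne.symm),
    card_erase_of_mem (mem_univ i), card_univ] at hcard
  have : 1 < Fintype.card V := Fintype.one_lt_card_iff.2 ⟨i, j, hne⟩
  lia

end SimpleGraph

/-- For `k ≥ 2`, every pseudo `k`-regular finite simple graph has at
least `k + 3` vertices. -/
theorem pseudoRegular_card_ge {V : Type*} [Fintype V]
    (G : SimpleGraph V) [DecidableRel G.Adj] (k : ℕ) (hk : 2 ≤ k)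
    (hG : G.IsPseudoRegular k) :
    k + 3 ≤ Fintype.card V := by
  classical
  obtain ⟨v, hv⟩ := hG.exists_lt_degree
  obtain ⟨-, hsum, hreg⟩ := hG
  by_contra! hn
  have hlt (i : V) : G.degree i < Fintype.card V := G.degree_lt_card_verts i
  have hv_lt := hlt v
  have hadj (j : V) (hj : v ≠ j) : G.Adj v j := by
    by_contra hvj
    have := SimpleGraph.degree_add_one_lt_card_of_not_adj hj hvj
    lia
  have hNv : G.neighborFinset v = univ.erase v := by
    ext j
    simp only [SimpleGraph.mem_neighborFinset, mem_erase, mem_univ, and_true]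
    exact ⟨fun h => h.ne', fun h => hadj j h.symm⟩
  have htotal : ∑ j, ((G.degree j : ℤ) - k) = (G.degree v : ℤ) - k := by
    have hz := SimpleGraph.sum_neighborFinset_degree_sub_eq_zero (hsum v)
    rw [hNv] at hz
    rw [← Finset.add_sum_erase _ _ (mem_univ v), hz, add_zero]
  obtain ⟨i, hi⟩ : ∃ i, G.degree i ≤ k := by
    by_contra! hgt
    exact hreg ⟨k + 1, fun i => by have := hgt i; have := hlt i; lia⟩
  have hcompl : ∑ j ∈ (G.neighborFinset i)ᶜ, ((G.degree j : ℤ) - k) ≤ 0 := by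
    refine Finset.sum_nonpos fun j hj => ?_
    rw [mem_compl, SimpleGraph.mem_neighborFinset] at hj
    rcases eq_or_ne j i with rfl | hji
    · lia
    · have := SimpleGraph.degree_add_one_lt_card_of_not_adj hji fun h => hj h.symm
      lia
  have hsplit := Finset.sum_add_sum_compl (G.neighborFinset i) fun j => (G.degree j : ℤ) - k
  rw [SimpleGraph.sum_neighborFinset_degree_sub_eq_zero (hsum i), htotal] at hsplit
  lia
end
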